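/- Let t, u ∈ ℂ with ‖t‖ < 1 and ‖u‖ < 1. Then the iterated normalized contour integral over |z| = 1 and |w| = 1 (each against dμ_{SU(2)}) and over |y| = 1 (against dy/(2πi y)) of PE_F[(z+1/z)(w+1/w); u] · PE_B[(z+1/z)(y+1/y); t] · PE_B[(w+1/w)(y+1/y); t] equals (1 − 2t²(u² − u + 1)u + u⁴)/(1 − t²)². This is the Hilbert–Poincaré series of (SO(4)×SO(2))-invariant form polynomials for the curved supercoset OSp(2|4)/(SO(4)×SO(2)). -/

import Mathlib

/-- Normalized contour integral `(2πi)⁻¹ ∮_{|z|=1} f(z) dz` over the positively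
oriented unit circle. -/
noncomputable def cint (f : ℂ → ℂ) : ℂ :=
  (2 * (Real.pi : ℂ) * Complex.I)⁻¹ * (∮ z in C(0, 1), f z)

/-- Normalized contour integral `∮ f(z) dz/(2πi z)`. -/
noncomputable def nint (f : ℂ → ℂ) : ℂ :=
  cint fun z => f z / z

/-- Bosonic plethystic exponential `PE_B[χ; t] = ∏_j (1 - t mⱼ)⁻¹`, for `χ` the
sum of the Laurent monomials `mⱼ` in the list `ms`. -/
noncomputable def PE_B (t : ℂ) (ms : List ℂ) : ℂ :=
  ((ms.map fun m => 1 - t * m).prod)⁻¹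

/-- Fermionic plethystic exponential `PE_F[χ; t] = ∏_j (1 - t mⱼ)`. -/
noncomputable def PE_F (t : ℂ) (ms : List ℂ) : ℂ :=
  (ms.map fun m => 1 - t * m).prod

open Metric

theorem nint_eq_circleAverage (f : ℂ → ℂ) : nint f = Real.circleAverage f 0 1 := by
  rw [Real.circleAverage_eq_circleIntegral one_ne_zero]
  simp [nint, cint, div_eq_inv_mul]

theorem nint_congr {f g : ℂ → ℂ} (h : ∀ z, ‖z‖ = 1 → f z = g z) : nint f = nint g := by
  rw [nint_eq_circleAverage, nint_eq_circleAverage]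
  exact Real.circleAverage_congr_sphere fun z hz => h z (by simpa using hz)

theorem nint_const_mul (c : ℂ) (f : ℂ → ℂ) : (nint fun z => c * f z) = c * nint f := by
  simp only [nint, cint, mul_div_assoc, circleIntegral.integral_const_mul]
  ring

/-- A function that splits on the unit circle into a part holomorphic on the disc and a part
holomorphic outside it has normalized contour integral the sum of the two central values. -/
theorem nint_eq_add_of_split {f p q : ℂ → ℂ} (hp : DifferentiableOn ℂ p (closedBall 0 1))
    (hq : DifferentiableOn ℂ q (closedBall 0 1))
    (h : ∀ z, ‖z‖ = 1 → f z = p z + q z⁻¹) : nint f = p 0 + q 0 := by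
  rw [nint_congr h, nint_eq_circleAverage]
  have hpi : CircleIntegrable p 0 1 :=
    (hp.continuousOn.mono sphere_subset_closedBall).circleIntegrable zero_le_one
  have hqi : CircleIntegrable (fun z => q z⁻¹) 0 1 := by
    refine ContinuousOn.circleIntegrable zero_le_one ?_
    refine hq.continuousOn.comp (continuousOn_inv₀.mono fun z hz => ?_) fun z hz => ?_
    · exact ne_zero_of_mem_unit_sphere ⟨z, hz⟩
    · have : ‖z‖ = 1 := by simpa using hz
      simp [this]
  have key : ∀ {g : ℂ → ℂ}, DifferentiableOn ℂ g (closedBall 0 1) →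
      Real.circleAverage g 0 1 = g 0 := fun {g} hg =>
    DiffContOnCl.circleAverage (by rw [abs_one]; exact hg.diffContOnCl_ball subset_rfl)
  have hadd := Real.circleAverage_add hpi hqi
  have hinv := Real.circleAverage_zero_one_congr_inv (f := q)
  rw [key hp] at hadd
  rw [key hq] at hinv
  rw [← hinv]
  exact hadd

theorem nint_swap {f : ℂ → ℂ → ℂ}
    (hf : ContinuousOn (Function.uncurry f) (sphere 0 1 ×ˢ sphere 0 1)) :
    (nint fun z => nint fun w => f z w) = nint fun w => nint fun z => f z w := by
  simp only [nint_eq_circleAverage, Real.circleAverage_def, intervalIntegral.integral_smul]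
  congr 2
  have hc : Continuous (Function.uncurry fun θ φ : ℝ => f (circleMap 0 1 θ) (circleMap 0 1 φ)) :=
    hf.comp_continuous (f := fun x : ℝ × ℝ => (circleMap 0 1 x.1, circleMap 0 1 x.2))
      (by fun_prop) fun x => by simp
  apply MeasureTheory.intervalIntegral_intervalIntegral_swap
  exact (hc.continuousOn.integrableOn_compact (isCompact_uIcc.prod isCompact_uIcc)).mono_set
    (Set.prod_mono Set.uIoc_subset_uIcc Set.uIoc_subset_uIcc)

theorem one_sub_ne_zero_of_norm {a w : ℂ} (ha : ‖a‖ < 1) (hw : ‖w‖ ≤ 1) : 1 - a * w ≠ 0 := by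
  intro h
  have : ‖a * w‖ = 1 := by rw [← sub_eq_zero.1 h, norm_one]
  rw [norm_mul] at this
  nlinarith [norm_nonneg a, norm_nonneg w]

theorem nint_weyl {a b : ℂ} (ha : ‖a‖ < 1) (hb : ‖b‖ < 1) (c₀ c₁ c₂ : ℂ) :
    (nint fun w => (1 - w ^ 2) * (c₀ + c₁ * (w + w⁻¹) + c₂ * (w ^ 2 + 1 + w⁻¹ ^ 2)) *
      ((1 - a * w) * (1 - a * w⁻¹) * ((1 - b * w) * (1 - b * w⁻¹)))⁻¹) =
    (c₀ + c₁ * (a + b) + c₂ * (a ^ 2 + a * b + b ^ 2)) / (1 - a * b) := by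
  have hab := one_sub_ne_zero_of_norm ha hb.le
  have hD : ∀ x ∈ closedBall (0 : ℂ) 1, (1 - a * b) * ((1 - a * x) * (1 - b * x)) ≠ 0 := by
    intro x hx
    have hx : ‖x‖ ≤ 1 := by simpa using hx
    exact mul_ne_zero hab
      (mul_ne_zero (one_sub_ne_zero_of_norm ha hx) (one_sub_ne_zero_of_norm hb hx))
  rw [nint_eq_add_of_split
    (p := fun w => (c₁ * w + c₂ * (w ^ 2 + (a + b) * w)) / (1 - a * b) -
      (c₀ * w ^ 2 + c₁ * (w ^ 3 + w) + c₂ * (w ^ 4 + w ^ 2 + 1)) /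
        ((1 - a * b) * ((1 - a * w) * (1 - b * w))))
    (q := fun x => (c₀ + c₁ * x + c₂ * (x ^ 2 + 1) + c₁ * ((a + b) - a * b * x) +
      c₂ * ((a ^ 2 + a * b + b ^ 2) - a * b * (a + b) * x)) /
        ((1 - a * b) * ((1 - a * x) * (1 - b * x))))]
  · field_simp
    ring
  · refine DifferentiableOn.sub (by fun_prop) (DifferentiableOn.div (by fun_prop) (by fun_prop) hD)
  · exact DifferentiableOn.div (by fun_prop) (by fun_prop) hD
  · intro w hw
    have hw0 : w ≠ 0 := by rintro rfl; simp at hw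
    have h1 : 1 - w * a ≠ 0 := mul_comm a w ▸ one_sub_ne_zero_of_norm ha hw.le
    have h2 : 1 - w * b ≠ 0 := mul_comm b w ▸ one_sub_ne_zero_of_norm hb hw.le
    have h3 : w - a ≠ 0 := by rintro h; rw [sub_eq_zero.1 h] at hw; linarith
    have h4 : w - b ≠ 0 := by rintro h; rw [sub_eq_zero.1 h] at hw; linarith
    have e1 : 1 - a * w⁻¹ = (w - a) / w := by field_simp
    have e2 : 1 - b * w⁻¹ = (w - b) / w := by field_simp
    simp only [e1, e2]
    field_simp
    ring

/-- The bosonic plethystic exponential of `(z + 1/z)(y + 1/y)`. -/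
noncomputable def bosonPE (t z y : ℂ) : ℂ :=
  PE_B t [z * y, z / y, y / z, 1 / (z * y)]

/-- The character `x² + 1 + x⁻²` of the adjoint representation of `SU(2)`. -/
noncomputable def adjChar (x : ℂ) : ℂ := x ^ 2 + 1 + x⁻¹ ^ 2

theorem bosonPE_eq (t z y : ℂ) :
    bosonPE t z y = ((1 - t * y * z) * (1 - t * y * z⁻¹) *
      ((1 - t * y⁻¹ * z) * (1 - t * y⁻¹ * z⁻¹)))⁻¹ := by
  simp only [bosonPE, PE_B, List.map_cons, List.map_nil, List.prod_cons, List.prod_nil]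
  congr 1
  simp only [div_eq_mul_inv, mul_inv, one_mul]
  ring

theorem PE_F_eq {z w : ℂ} (hz : z ≠ 0) (hw : w ≠ 0) (u : ℂ) :
    PE_F u [z * w, z / w, w / z, 1 / (z * w)] =
      1 + u ^ 4 + u ^ 2 * adjChar z + -(u + u ^ 3) * (z + z⁻¹) * (w + w⁻¹) +
        u ^ 2 * adjChar w := by
  simp only [PE_F, adjChar, List.map_cons, List.map_nil, List.prod_cons, List.prod_nil]
  field_simp
  ring

theorem nint_weyl_bosonPE {t y : ℂ} (ht : ‖t‖ < 1) (hy : ‖y‖ = 1) (c₀ c₁ c₂ : ℂ) :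
    (nint fun w => (1 - w ^ 2) * (c₀ + c₁ * (w + w⁻¹) + c₂ * adjChar w) * bosonPE t w y) =
      (c₀ + c₁ * (t * (y + y⁻¹)) + c₂ * (t ^ 2 * adjChar y)) / (1 - t ^ 2) := by
  have hy0 : y ≠ 0 := by rintro rfl; simp at hy
  simp only [bosonPE_eq, adjChar]
  rw [nint_weyl (by simpa [hy] using ht) (by simpa [hy] using ht)]
  field_simp

theorem continuousOn_inv_sphere : ContinuousOn (fun x : ℂ => x⁻¹) (sphere 0 1) :=
  continuousOn_inv₀.mono fun _ hz => ne_zero_of_mem_unit_sphere ⟨_, hz⟩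

theorem continuousOn_bosonPE {t : ℂ} (ht : ‖t‖ < 1) :
    ContinuousOn (fun p : ℂ × ℂ => bosonPE t p.1 p.2) (sphere 0 1 ×ˢ sphere 0 1) := by
  have h1 : ContinuousOn (fun p : ℂ × ℂ => p.1⁻¹) (sphere 0 1 ×ˢ sphere 0 1) :=
    continuousOn_inv_sphere.comp continuousOn_fst fun p hp => hp.1
  have h2 : ContinuousOn (fun p : ℂ × ℂ => p.2⁻¹) (sphere 0 1 ×ˢ sphere 0 1) :=
    continuousOn_inv_sphere.comp continuousOn_snd fun p hp => hp.2
  simp only [bosonPE_eq]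
  refine ContinuousOn.inv₀ (by fun_prop) ?_
  rintro ⟨z, y⟩ ⟨hz, hy⟩
  have hz : ‖z‖ = 1 := by simpa using hz
  have hy : ‖y‖ = 1 := by simpa using hy
  refine mul_ne_zero (mul_ne_zero ?_ ?_) (mul_ne_zero ?_ ?_) <;>
    exact one_sub_ne_zero_of_norm (by simpa [hy] using ht) (by simp [hz])

theorem nint_weyl_nint_PE {t z : ℂ} (ht : ‖t‖ < 1) (u : ℂ) (hz : ‖z‖ = 1) :
    (nint fun w => (1 - w ^ 2) * nint fun y =>
      PE_F u [z * w, z / w, w / z, 1 / (z * w)] * bosonPE t z y * bosonPE t w y) =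
    nint fun y => (1 + u ^ 4 + u ^ 2 * (t ^ 2 * adjChar y) +
      -(u + u ^ 3) * (t * (y + y⁻¹)) * (z + z⁻¹) + u ^ 2 * adjChar z) * bosonPE t z y *
        (1 - t ^ 2)⁻¹ := by
  have hz0 : z ≠ 0 := by rintro rfl; simp at hz
  have hB := continuousOn_bosonPE ht
  have hBz : ContinuousOn (fun p : ℂ × ℂ => bosonPE t z p.2) (sphere 0 1 ×ˢ sphere 0 1) :=
    hB.comp (f := fun p : ℂ × ℂ => (z, p.2)) (by fun_prop)
      fun p hp => ⟨by simpa using hz, hp.2⟩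
  have h1 : ContinuousOn (fun p : ℂ × ℂ => p.1⁻¹) (sphere 0 1 ×ˢ sphere 0 1) :=
    continuousOn_inv_sphere.comp continuousOn_fst fun p hp => hp.1
  calc
    _ = nint fun w => nint fun y => bosonPE t z y * ((1 - w ^ 2) *
        (1 + u ^ 4 + u ^ 2 * adjChar z + -(u + u ^ 3) * (z + z⁻¹) * (w + w⁻¹) +
          u ^ 2 * adjChar w) * bosonPE t w y) := nint_congr fun w hw => by
      have hw0 : w ≠ 0 := by rintro rfl; simp at hw
      rw [← nint_const_mul]
      refine nint_congr fun y _ => ?_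
      rw [PE_F_eq hz0 hw0]
      ring
    _ = _ := by
      rw [nint_swap]
      · refine nint_congr fun y hy => ?_
        rw [nint_const_mul, nint_weyl_bosonPE ht hy]
        ring
      · simp only [Function.uncurry_def, adjChar]
        fun_prop

theorem nint_laurent (A B C : ℂ) :
    (nint fun y => A + B * adjChar y + C * (y + y⁻¹) ^ 2) = A + B + 2 * C := by
  rw [nint_eq_add_of_split (p := fun y => A + B * (y ^ 2 + 1) + C * (y ^ 2 + 2))
    (q := fun y => B * y ^ 2 + C * y ^ 2) (by fun_prop) (by fun_prop)]
  · ring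
  · intro y hy
    have hy0 : y ≠ 0 := by rintro rfl; simp at hy
    simp only [adjChar]
    field_simp
    ring

/-- Hilbert–Poincaré series of `(SO(4)×SO(2))`-invariant form polynomials for
the curved supercoset `OSp(2|4)/(SO(4)×SO(2))`. -/
theorem statement_6 (t u : ℂ) (ht : ‖t‖ < 1) (hu : ‖u‖ < 1) :
    (nint fun z => (1 - z ^ 2) *
      nint fun w => (1 - w ^ 2) *
        nint fun y =>
          PE_F u [z * w, z / w, w / z, 1 / (z * w)] *
          PE_B t [z * y, z / y, y / z, 1 / (z * y)] *
          PE_B t [w * y, w / y, y / w, 1 / (w * y)])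
      = (1 - 2 * t ^ 2 * (u ^ 2 - u + 1) * u + u ^ 4) / (1 - t ^ 2) ^ 2 := by
  have hB := continuousOn_bosonPE ht
  have h1 : ContinuousOn (fun p : ℂ × ℂ => p.1⁻¹) (sphere 0 1 ×ˢ sphere 0 1) :=
    continuousOn_inv_sphere.comp continuousOn_fst fun p hp => hp.1
  have h2 : ContinuousOn (fun p : ℂ × ℂ => p.2⁻¹) (sphere 0 1 ×ˢ sphere 0 1) :=
    continuousOn_inv_sphere.comp continuousOn_snd fun p hp => hp.2
  have ht2 : 1 - t ^ 2 ≠ 0 := by simpa [sq] using one_sub_ne_zero_of_norm ht ht.le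
  calc
    _ = nint fun z => nint fun y => (1 - t ^ 2)⁻¹ * ((1 - z ^ 2) *
        (1 + u ^ 4 + u ^ 2 * (t ^ 2 * adjChar y) +
          -(u + u ^ 3) * (t * (y + y⁻¹)) * (z + z⁻¹) + u ^ 2 * adjChar z) *
            bosonPE t z y) := nint_congr fun z hz => by
      refine (congrArg _ (nint_weyl_nint_PE ht u hz)).trans ?_
      rw [← nint_const_mul]
      refine nint_congr fun y _ => ?_
      ring
    _ = nint fun y => (1 + u ^ 4) * ((1 - t ^ 2) ^ 2)⁻¹ +
        2 * u ^ 2 * t ^ 2 * ((1 - t ^ 2) ^ 2)⁻¹ * adjChar y +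
          -(u + u ^ 3) * t ^ 2 * ((1 - t ^ 2) ^ 2)⁻¹ * (y + y⁻¹) ^ 2 := by
      rw [nint_swap]
      · refine nint_congr fun y hy => ?_
        rw [nint_const_mul, nint_weyl_bosonPE ht hy]
        field_simp
        ring
      · simp only [Function.uncurry_def, adjChar]
        fun_prop
    _ = _ := by
      rw [nint_laurent]
      field_simp
      ring
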